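/- Fix n ≥ 3 and let λ : L_n → GL_n(ℂ) be a 2-local representation, i.e. λ(ℓ_i) = diag(I_{i-1}, M_i, I_{n-i-1}) with M_i ∈ GL_2(ℂ) for each 1 ≤ i ≤ n-1. Then there exists a group homomorphism λ̂₂ : VL_n → GL_n(ℂ) with λ̂₂(ℓ_i) = λ(ℓ_i) and λ̂₂(ρ_i) = -λ(ℓ_i) for all 1 ≤ i ≤ n-1. Moreover λ̂₂ respects the welded relations, i.e. it induces a group homomorphism WL_n → GL_n(ℂ). -/

import Mathlib

/-- The defining relations of the triplet group `L_n`: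
generators `l_1, ..., l_{n-1}` (indexed here by `Fin (n-1)`, index `i` corresponding
to `l_{i+1}`), and relations `l_i ^ 2 = 1`, `l_i l_{i+1} l_i = l_{i+1} l_i l_{i+1}`. -/
def tripletRels (n : ℕ) : Set (FreeGroup (Fin (n - 1))) :=
  {r | (∃ i : Fin (n - 1), r = FreeGroup.of i * FreeGroup.of i) ∨
    ∃ i j : Fin (n - 1), (i : ℕ) + 1 = (j : ℕ) ∧
      r = FreeGroup.of i * FreeGroup.of j * FreeGroup.of i *
          (FreeGroup.of j * FreeGroup.of i * FreeGroup.of j)⁻¹}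

/-- The triplet group `L_n`. -/
abbrev TripletGroup (n : ℕ) := PresentedGroup (tripletRels n)

/-- The generator `l_{i+1}` of the triplet group. -/
def ell {n : ℕ} (i : Fin (n - 1)) : TripletGroup n := PresentedGroup.of i

/-- The `n x n` matrix `diag(I_i, M, I_{n-i-2})`: it agrees with the identity matrix
except in the `2 x 2` block in rows/columns `i, i+1` (0-based), where it equals `M`. -/
def locMat {R : Type*} [CommRing R] (n : ℕ) (i : ℕ)
    (M : Matrix (Fin 2) (Fin 2) R) : Matrix (Fin n) (Fin n) R :=
  Matrix.of fun a b =>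
    if (a : ℕ) = i ∧ (b : ℕ) = i then M 0 0
    else if (a : ℕ) = i ∧ (b : ℕ) = i + 1 then M 0 1
    else if (a : ℕ) = i + 1 ∧ (b : ℕ) = i then M 1 0
    else if (a : ℕ) = i + 1 ∧ (b : ℕ) = i + 1 then M 1 1
    else if (a : ℕ) = (b : ℕ) then 1 else 0

/-- The defining relations of the virtual triplet group `VL_n`: generators
`l_i = Sum.inl i` and `rho_i = Sum.inr i` for `i : Fin (n-1)` (0-based), with the
triplet relations on the `l_i`, together with `rho_i ^ 2 = 1`,
`rho_i rho_j = rho_j rho_i` for `|i-j| >= 2`,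
`rho_i rho_{i+1} rho_i = rho_{i+1} rho_i rho_{i+1}`, `l_i rho_j = rho_j l_i` for
`|i-j| >= 2`, and `rho_i rho_{i+1} l_i = l_{i+1} rho_i rho_{i+1}`. -/
def vtripletRels (n : ℕ) : Set (FreeGroup (Fin (n - 1) ⊕ Fin (n - 1))) :=
  {r | (∃ i : Fin (n - 1), r = FreeGroup.of (.inl i) * FreeGroup.of (.inl i)) ∨
    (∃ i j : Fin (n - 1), (i : ℕ) + 1 = (j : ℕ) ∧
      r = FreeGroup.of (.inl i) * FreeGroup.of (.inl j) * FreeGroup.of (.inl i) *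
          (FreeGroup.of (.inl j) * FreeGroup.of (.inl i) * FreeGroup.of (.inl j))⁻¹) ∨
    (∃ i : Fin (n - 1), r = FreeGroup.of (.inr i) * FreeGroup.of (.inr i)) ∨
    (∃ i j : Fin (n - 1), ((i : ℕ) + 2 ≤ (j : ℕ) ∨ (j : ℕ) + 2 ≤ (i : ℕ)) ∧
      r = FreeGroup.of (.inr i) * FreeGroup.of (.inr j) *
          (FreeGroup.of (.inr j) * FreeGroup.of (.inr i))⁻¹) ∨
    (∃ i j : Fin (n - 1), (i : ℕ) + 1 = (j : ℕ) ∧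
      r = FreeGroup.of (.inr i) * FreeGroup.of (.inr j) * FreeGroup.of (.inr i) *
          (FreeGroup.of (.inr j) * FreeGroup.of (.inr i) * FreeGroup.of (.inr j))⁻¹) ∨
    (∃ i j : Fin (n - 1), ((i : ℕ) + 2 ≤ (j : ℕ) ∨ (j : ℕ) + 2 ≤ (i : ℕ)) ∧
      r = FreeGroup.of (.inl i) * FreeGroup.of (.inr j) *
          (FreeGroup.of (.inr j) * FreeGroup.of (.inl i))⁻¹) ∨
    (∃ i j : Fin (n - 1), (i : ℕ) + 1 = (j : ℕ) ∧
      r = FreeGroup.of (.inr i) * FreeGroup.of (.inr j) * FreeGroup.of (.inl i) *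
          (FreeGroup.of (.inl j) * FreeGroup.of (.inr i) * FreeGroup.of (.inr j))⁻¹)}

/-- The virtual triplet group `VL_n`. -/
abbrev VTripletGroup (n : ℕ) := PresentedGroup (vtripletRels n)

/-- The generator `l_{i+1}` of `VL_n`. -/
def ellV {n : ℕ} (i : Fin (n - 1)) : VTripletGroup n := PresentedGroup.of (Sum.inl i)

/-- The generator `rho_{i+1}` of `VL_n`. -/
def rhoV {n : ℕ} (i : Fin (n - 1)) : VTripletGroup n := PresentedGroup.of (Sum.inr i)

/-- The defining relations of the welded triplet group `WL_n`: those of `VL_n` together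
with the welded relations `rho_i l_{i+1} l_i = l_{i+1} l_i rho_{i+1}`. -/
def wtripletRels (n : ℕ) : Set (FreeGroup (Fin (n - 1) ⊕ Fin (n - 1))) :=
  vtripletRels n ∪
    {r | ∃ i j : Fin (n - 1), (i : ℕ) + 1 = (j : ℕ) ∧
      r = FreeGroup.of (.inr i) * FreeGroup.of (.inl j) * FreeGroup.of (.inl i) *
          (FreeGroup.of (.inl j) * FreeGroup.of (.inl i) * FreeGroup.of (.inr j))⁻¹}

/-- The welded triplet group `WL_n`. -/
abbrev WTripletGroup (n : ℕ) := PresentedGroup (wtripletRels n)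

/-- The generator `l_{i+1}` of `WL_n`. -/
def ellW {n : ℕ} (i : Fin (n - 1)) : WTripletGroup n := PresentedGroup.of (Sum.inl i)

/-- The generator `rho_{i+1}` of `WL_n`. -/
def rhoW {n : ℕ} (i : Fin (n - 1)) : WTripletGroup n := PresentedGroup.of (Sum.inr i)

theorem locMat_sub_one_apply_eq_zero {R : Type*} [CommRing R] {n i : ℕ}
    (M : Matrix (Fin 2) (Fin 2) R) {a b : Fin n}
    (h : ((a : ℕ) ≠ i ∧ (a : ℕ) ≠ i + 1) ∨ ((b : ℕ) ≠ i ∧ (b : ℕ) ≠ i + 1)) :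
    (locMat n i M - 1) a b = 0 := by
  rcases h with ⟨h₁, h₂⟩ | ⟨h₁, h₂⟩ <;>
    simp [locMat, Matrix.one_apply, h₁, h₂, Fin.ext_iff]

theorem locMat_sub_one_mul_locMat_sub_one {R : Type*} [CommRing R] {n i j : ℕ}
    (h : i + 2 ≤ j ∨ j + 2 ≤ i) (M N : Matrix (Fin 2) (Fin 2) R) :
    (locMat n i M - 1) * (locMat n j N - 1) = 0 := by
  ext a b
  rw [Matrix.mul_apply]
  refine Finset.sum_eq_zero fun k _ => ?_
  by_cases hk : (k : ℕ) ≠ i ∧ (k : ℕ) ≠ i + 1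
  · rw [locMat_sub_one_apply_eq_zero M (.inr hk), zero_mul]
  · rw [locMat_sub_one_apply_eq_zero N (.inl (by omega)), mul_zero]

theorem locMat_commute {R : Type*} [CommRing R] {n i j : ℕ}
    (h : i + 2 ≤ j ∨ j + 2 ≤ i) (M N : Matrix (Fin 2) (Fin 2) R) :
    Commute (locMat n i M) (locMat n j N) := by
  have hsub : Commute (locMat n i M - 1) (locMat n j N - 1) :=
    (locMat_sub_one_mul_locMat_sub_one h M N).trans
      (locMat_sub_one_mul_locMat_sub_one h.symm N M).symm
  simpa using (hsub.add_left (Commute.one_left _)).add_right (Commute.one_right _)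

theorem ell_mul_self {n : ℕ} (i : Fin (n - 1)) : (ell i : TripletGroup n) * ell i = 1 :=
  PresentedGroup.one_of_mem (rels := tripletRels n) (.inl ⟨i, rfl⟩)

theorem ell_braid {n : ℕ} {i j : Fin (n - 1)} (h : (i : ℕ) + 1 = j) :
    (ell i : TripletGroup n) * ell j * ell i = ell j * ell i * ell j :=
  PresentedGroup.mk_eq_mk_of_mul_inv_mem (rels := tripletRels n) (.inr ⟨i, j, h, rfl⟩)

/-- Involutions satisfying the braid relations and far commutativity, together with their
negatives, satisfy the relations of the welded triplet group. -/
theorem lift_wtripletRels_eq_one {G : Type*} [Group G] [HasDistribNeg G] {n : ℕ}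
    (g : Fin (n - 1) → G) (hsq : ∀ i, g i * g i = 1)
    (hbraid : ∀ i j : Fin (n - 1), (i : ℕ) + 1 = j → g i * g j * g i = g j * g i * g j)
    (hcomm : ∀ i j : Fin (n - 1), ((i : ℕ) + 2 ≤ j ∨ (j : ℕ) + 2 ≤ i) → g i * g j = g j * g i) :
    ∀ r ∈ wtripletRels n, FreeGroup.lift (Sum.elim g fun i => -g i) r = 1 := by
  rintro _ ((⟨i, rfl⟩ | ⟨i, j, h, rfl⟩ | ⟨i, rfl⟩ | ⟨i, j, h, rfl⟩ | ⟨i, j, h, rfl⟩ |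
    ⟨i, j, h, rfl⟩ | ⟨i, j, h, rfl⟩) | ⟨i, j, h, rfl⟩) <;>
    simp only [map_mul, map_inv, FreeGroup.lift_apply_of, Sum.elim_inl, Sum.elim_inr,
      mul_inv_eq_one]
  all_goals try simp only [neg_mul, mul_neg, neg_neg, neg_inj, hsq]
  all_goals first | exact hbraid i j h | exact hcomm i j h

/-- Fix `n >= 3` and let `lam : L_n → GL_n(ℂ)` be a 2-local
representation. Then there is a group homomorphism `lam2 : VL_n → GL_n(ℂ)` with
`lam2 (l_i) = lam (l_i)` and `lam2 (rho_i) = - lam (l_i)` for all `i`; moreover it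
respects the welded relations, i.e. it also induces a homomorphism `WL_n → GL_n(ℂ)`
with the same values on generators. -/
theorem two_local_extends_negative (n : ℕ) (hn : 3 ≤ n)
    (lam : TripletGroup n →* Matrix.GeneralLinearGroup (Fin n) ℂ)
    (M : Fin (n - 1) → Matrix (Fin 2) (Fin 2) ℂ)
    (hloc : ∀ i : Fin (n - 1), Units.val (lam (ell i)) = locMat n (i : ℕ) (M i)) :
    (∃ lam2 : VTripletGroup n →* Matrix.GeneralLinearGroup (Fin n) ℂ,
      (∀ i : Fin (n - 1), Units.val (lam2 (ellV i)) = Units.val (lam (ell i))) ∧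
      (∀ i : Fin (n - 1), Units.val (lam2 (rhoV i)) = - Units.val (lam (ell i)))) ∧
    (∃ lam2W : WTripletGroup n →* Matrix.GeneralLinearGroup (Fin n) ℂ,
      (∀ i : Fin (n - 1), Units.val (lam2W (ellW i)) = Units.val (lam (ell i))) ∧
      (∀ i : Fin (n - 1), Units.val (lam2W (rhoW i)) = - Units.val (lam (ell i)))) := by
  have hrels := lift_wtripletRels_eq_one (fun i => lam (ell i))
    (fun i => by rw [← map_mul, ell_mul_self, map_one])
    (fun i j h => by simp only [← map_mul, ell_braid h])
    (fun i j h => Units.ext <| by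
      rw [Units.val_mul, Units.val_mul, hloc, hloc]
      exact locMat_commute h _ _)
  refine ⟨⟨PresentedGroup.toGroup fun r hr => hrels r (.inl hr), fun i => ?_, fun i => ?_⟩,
    ⟨PresentedGroup.toGroup hrels, fun i => ?_, fun i => ?_⟩⟩
  · simp [ellV]
  · simp [rhoV]
  · simp [ellW]
  · simp [rhoW]
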